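/- Let A be a Dedekind domain, p a nonzero prime of A, and H a finitely generated torsion-free (hence locally free) A-module embedded in a finitely generated free A_p-module Ĥ such that H ∩ pĤ = pH. Then the induced A_p-linear map A_p ⊗_A H → Ĥ is injective and its image is a direct summand of Ĥ. In particular it is an isomorphism if and only if rk_A(H) = rk_{A_p}(Ĥ). -/

import Mathlib

universe u v w

open TensorProduct IsLocalRing in
/-- Let `A → B` be a ring map to a local ring with surjective composite to the residue field, and
let `p` be an ideal of `A` generating the maximal ideal of `B`. An `A`-linear map to a finite free
`B`-module whose reduction modulo `p` is injective extends to a split injection of `B`-modules. -/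
theorem LinearMap.exists_leftInverse_liftBaseChange_of_isLocalRing
    {A B M N : Type*} [CommRing A] [CommRing B] [IsLocalRing B] [Algebra A B]
    [AddCommGroup M] [Module A M] [Module.Finite A M]
    [AddCommGroup N] [Module A N] [Module B N] [IsScalarTower A B N]
    [Module.Finite B N] [Module.Free B N]
    {p : Ideal A} (hp : p.map (algebraMap A B) = maximalIdeal B)
    (hsurj : Function.Surjective (algebraMap A (ResidueField B)))
    (f : M →ₗ[A] N)
    (hf : ∀ x, f x ∈ maximalIdeal B • (⊤ : Submodule B N) → x ∈ p • (⊤ : Submodule A M)) :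
    ∃ g, g ∘ₗ f.liftBaseChange B = LinearMap.id := by
  rw [IsLocalRing.split_injective_iff_lTensor_residueField_injective,
    injective_iff_map_eq_zero]
  have hrep : ∀ x : ResidueField B ⊗[B] (B ⊗[A] M), ∃ m : M, x = 1 ⊗ₜ (1 ⊗ₜ m) := by
    intro x
    induction x with
    | zero => exact ⟨0, by simp⟩
    | add x y hx hy =>
      obtain ⟨a, rfl⟩ := hx
      obtain ⟨b, rfl⟩ := hy
      exact ⟨a + b, by simp [tmul_add]⟩
    | tmul a y =>
      induction y with
      | zero => exact ⟨0, by simp⟩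
      | add x y hx hy =>
        obtain ⟨m, hm⟩ := hx
        obtain ⟨n, hn⟩ := hy
        exact ⟨m + n, by simp [tmul_add, hm, hn]⟩
      | tmul b m =>
        obtain ⟨c, hc⟩ := hsurj (residue B b * a)
        refine ⟨c • m, ?_⟩
        have h₁ : b ⊗ₜ[A] m = b • ((1 : B) ⊗ₜ[A] m) := by simp [smul_tmul']
        have h₂ : (1 : B) ⊗ₜ[A] (c • m) = algebraMap A B c • ((1 : B) ⊗ₜ[A] m) := by
          rw [tmul_smul, algebraMap_smul]
        rw [h₁, h₂, ← smul_tmul, ← smul_tmul, Algebra.smul_def, Algebra.smul_def, mul_one,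
          ← IsScalarTower.algebraMap_apply, hc, ResidueField.algebraMap_eq]
  intro x hx
  obtain ⟨m, rfl⟩ := hrep x
  have hm : f m ∈ maximalIdeal B • (⊤ : Submodule B N) := by
    let e : ResidueField B ⊗[B] N ≃ₗ[B] N ⧸ (maximalIdeal B • ⊤ : Submodule B N) :=
      quotTensorEquivQuotSMul N (maximalIdeal B)
    have he : e (1 ⊗ₜ f m) = Submodule.Quotient.mk ((1 : B) • f m) :=
      quotTensorEquivQuotSMul_mk_tmul (maximalIdeal B) 1 (f m)
    rw [LinearMap.lTensor_tmul, LinearMap.liftBaseChange_tmul, one_smul] at hx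
    rwa [hx, map_zero, one_smul, eq_comm, Submodule.Quotient.mk_eq_zero] at he
  refine Submodule.smul_induction_on (hf m hm) (fun a ha n _ ↦ ?_) fun x y hx hy ↦ ?_
  · have h : (1 : B) ⊗ₜ[A] (a • n) = algebraMap A B a • ((1 : B) ⊗ₜ[A] n) := by
      rw [tmul_smul, algebraMap_smul]
    rw [h, ← smul_tmul, Algebra.smul_def, mul_one, ResidueField.algebraMap_eq,
      (residue_eq_zero_iff _).mpr (hp ▸ Ideal.mem_map_of_mem _ ha), zero_tmul]
  · rw [tmul_add, tmul_add, hx, hy, add_zero]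

open TensorProduct in
/-- The rank of a finite flat module over a domain is invariant under base change to a nontrivial
ring over which it becomes free. -/
theorem Module.finrank_baseChange_of_flat {A B M : Type*} [CommRing A] [IsDomain A]
    [CommRing B] [Nontrivial B] [Algebra A B] [AddCommGroup M] [Module A M] [Module.Finite A M]
    [Module.Flat A M] [Module.Free B (B ⊗[A] M)] :
    Module.finrank B (B ⊗[A] M) = Module.finrank A M := by
  obtain ⟨P⟩ : Nonempty (PrimeSpectrum B) := inferInstance
  rw [← Ideal.finrank_fiber_eq_finrank (P.comap (algebraMap A B)).asIdeal,
    ← Module.rankAtStalk_eq, ← Module.rankAtStalk_baseChange, Module.rankAtStalk_eq_finrank_of_free,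
    Pi.natCast_apply, Nat.cast_id]

namespace AdicCompletion

variable {A : Type*} [CommRing A] (m : Ideal A) [m.IsMaximal]

theorem isLocalRing_of_isMaximal (fg : m.FG) : IsLocalRing (AdicCompletion m A) := by
  have := isMaximal_map_of_le m m le_rfl fg
  have := isAdicComplete_self m fg
  exact isLocalRing_of_isAdicComplete_maximal (m.map (algebraMap A (AdicCompletion m A)))

theorem map_eq_maximalIdeal (fg : m.FG) [IsLocalRing (AdicCompletion m A)] :
    m.map (algebraMap A (AdicCompletion m A)) = IsLocalRing.maximalIdeal (AdicCompletion m A) :=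
  IsLocalRing.eq_maximalIdeal (isMaximal_map_of_le m m le_rfl fg)

theorem algebraMap_residueField_surjective (fg : m.FG) [IsLocalRing (AdicCompletion m A)] :
    Function.Surjective
      (algebraMap A (IsLocalRing.ResidueField (AdicCompletion m A))) := by
  intro x
  obtain ⟨b, rfl⟩ := IsLocalRing.residue_surjective x
  obtain ⟨a, ha⟩ := Ideal.Quotient.mk_surjective (evalOneₐ m b)
  refine ⟨a, ?_⟩
  rw [IsScalarTower.algebraMap_apply A (AdicCompletion m A), IsLocalRing.ResidueField.algebraMap_eq,
    ← sub_eq_zero, ← map_sub, IsLocalRing.residue_eq_zero_iff, ← map_eq_maximalIdeal m fg,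
    ← ker_evalOneₐ_eq_map m fg]
  change evalOneₐ m (algebraMap A _ a - b) = 0
  rw [map_sub, ← ha, AlgHom.commutes]
  exact sub_self _

end AdicCompletion

/-- **Saturated finitely generated submodules extend to direct summands of the completion.**
Let `A` be a Dedekind domain, `p` a nonzero prime of `A` with completion `A_p`
(`AdicCompletion p A`), `H` a finitely generated torsion-free (hence locally free) `A`-module
embedded (via `ι`) in a finitely generated free `A_p`-module `Hhat` satisfying the saturation
condition `H ∩ pHhat = pH`.  Then the induced `A_p`-linear map `A_p ⊗_A H → Hhat` is injective
and its image is a direct summand of `Hhat`.  In particular it is an isomorphism if and only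
if `rk_A H = rk_{A_p} Hhat`. -/
theorem saturated_submodule_direct_summand_of_completion
    (A : Type u) [CommRing A] [IsDomain A] [IsDedekindDomain A]
    (p : Ideal A) (hp : p.IsPrime) (hp0 : p ≠ ⊥)
    (H : Type v) [AddCommGroup H] [Module A H]
    [Module.Finite A H] [NoZeroSMulDivisors A H]
    (Hhat : Type w) [AddCommGroup Hhat] [Module (AdicCompletion p A) Hhat]
    [Module A Hhat] [IsScalarTower A (AdicCompletion p A) Hhat]
    [Module.Finite (AdicCompletion p A) Hhat] [Module.Free (AdicCompletion p A) Hhat]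
    (ι : H →ₗ[A] Hhat) (hι : Function.Injective ι)
    (hsat : ∀ h : H,
      ι h ∈ (p.map (algebraMap A (AdicCompletion p A))) •
          (⊤ : Submodule (AdicCompletion p A) Hhat) ↔ h ∈ p • (⊤ : Submodule A H)) :
    Function.Injective (LinearMap.liftBaseChange (AdicCompletion p A) ι) ∧
    (∃ K : Submodule (AdicCompletion p A) Hhat,
      IsCompl (LinearMap.range (LinearMap.liftBaseChange (AdicCompletion p A) ι)) K) ∧
    (Function.Bijective (LinearMap.liftBaseChange (AdicCompletion p A) ι) ↔
      Cardinal.lift.{w} (Module.rank A H) = Cardinal.lift.{v} (Module.rank (AdicCompletion p A) Hhat)) := by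
  have : Module.IsTorsionFree A H := inferInstance
  have : p.IsMaximal := hp.isMaximal hp0
  have fg : p.FG := p.fg_of_isNoetherianRing
  have : IsLocalRing (AdicCompletion p A) := AdicCompletion.isLocalRing_of_isMaximal p fg
  have hmax := AdicCompletion.map_eq_maximalIdeal p fg
  obtain ⟨g, hg⟩ := ι.exists_leftInverse_liftBaseChange_of_isLocalRing hmax
    (AdicCompletion.algebraMap_residueField_surjective p fg) fun x hx ↦
      (hsat x).mp (hmax ▸ hx)
  have hleft : Function.LeftInverse g (ι.liftBaseChange (AdicCompletion p A)) :=
    LinearMap.congr_fun hg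
  have : Module.Free (AdicCompletion p A) (TensorProduct A (AdicCompletion p A) H) :=
    Module.free_of_flat_of_isLocalRing
  have hrank := Module.finrank_baseChange_of_flat (A := A) (B := AdicCompletion p A) (M := H)
  refine ⟨hleft.injective, ⟨_, LinearMap.isCompl_of_proj
    (f := (ι.liftBaseChange (AdicCompletion p A)).rangeRestrict ∘ₗ g) ?_⟩, ?_⟩
  · rintro ⟨_, x, rfl⟩
    exact Subtype.ext (congrArg (ι.liftBaseChange (AdicCompletion p A)) (hleft x))
  have hiff : Cardinal.lift.{w} (Module.rank A H) =
      Cardinal.lift.{v} (Module.rank (AdicCompletion p A) Hhat) ↔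
      Module.finrank A H = Module.finrank (AdicCompletion p A) Hhat := by
    rw [← Module.finrank_eq_rank A H, ← Module.finrank_eq_rank (AdicCompletion p A) Hhat,
      Cardinal.lift_natCast, Cardinal.lift_natCast, Nat.cast_inj]
  rw [hiff, ← hrank]
  refine ⟨fun h ↦ (LinearEquiv.ofBijective _ h).finrank_eq, fun h ↦ ?_⟩
  have hbij := OrzechProperty.bijective_of_surjective_of_finrank_le g hleft.surjective h.ge
  exact ⟨hleft.injective, (hleft.rightInverse_of_injective hbij.injective).surjective⟩
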